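/- Assume ψ : ℝ^N → ℂ is smooth, ℤ^N-periodic, with ∫_{[0,1]^N}|ψ|²dy = 1 and 𝔸ψ = 0. Fix h, k ∈ {1,…,N}, let A₁ : ℝ^N → ℝ^{N×N} be a smooth ℤ^N-periodic symmetric-matrix-valued function and c₁ : ℝ^N → ℝ a smooth ℤ^N-periodic function. Assume φ_k, χ_h : ℝ^N → ℂ are smooth ℤ^N-periodic functions satisfying 𝔸φ_k = 2iπ e_k·(A(∇+2iπθ⁰)ψ) + div(2iπ A e_k ψ) + 2iπθ⁰·(2iπ A e_k ψ) and 𝔸χ_h = div(A₁(∇+2iπθ⁰)ψ) + 2iπθ⁰·(A₁(∇+2iπθ⁰)ψ) − c₁ψ. Assume moreover that there exist a smooth ℤ^N-periodic function ξ and a constant Λ ∈ ℂ such that 𝔸ξ = div(A₁(∇+2iπθ⁰)φ_k) + 2iπθ⁰·(A₁(∇+2iπθ⁰)φ_k) − c₁φ_k + 2iπ e_k·(A(∇+2iπθ⁰)χ_h) + div(2iπ A e_k χ_h) + 2iπθ⁰·(2iπ A e_k χ_h) + 2iπ e_k·(A₁(∇+2iπθ⁰)ψ) + div(2iπ A₁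 e_k ψ) + 2iπθ⁰·(2iπ A₁ e_k ψ) + Λψ. Then ∫_{[0,1]^N} (1/(2iπ))[ A₁(∇+2iπθ⁰)φ_k·(∇−2iπθ⁰)conj(ψ) + c₁ φ_k conj(ψ) ] dy + ∫_{[0,1]^N}[ (A₁ e_k)ψ·(∇−2iπθ⁰)conj(ψ) + (A e_k)χ_h·(∇−2iπθ⁰)conj(ψ) ] dy − ∫_{[0,1]^N}[ (A₁ e_k)·((∇+2iπθ⁰)ψ)·conj(ψ) + (A e_k)·((∇+2iπθ⁰)χ_h)·conj(ψ) ] dy − (1/(2iπ))Λ = 0. -/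

import Mathlib

open MeasureTheory Real ComplexConjugate

/-- Partial derivative `∂ₖ f` of a function on `ℝ^N`. -/
noncomputable def pd {N : ℕ} (f : (Fin N → ℝ) → ℂ) (k : Fin N) (y : Fin N → ℝ) : ℂ :=
  fderiv ℝ f y (Pi.single k 1)

/-- `ℤ^N`-periodicity. -/
def ZNPeriodic {N : ℕ} {α : Type*} (f : (Fin N → ℝ) → α) : Prop :=
  ∀ q : Fin N → ℤ, ∀ y : Fin N → ℝ, f (fun i => y i + (q i : ℝ)) = f y

/-- `l`-th component of `(∇ + 2iπθ)χ`. -/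
noncomputable def gp {N : ℕ} (θ : Fin N → ℝ) (χ : (Fin N → ℝ) → ℂ) (l : Fin N)
    (y : Fin N → ℝ) : ℂ :=
  pd χ l y + 2 * (π : ℂ) * Complex.I * (θ l : ℂ) * χ y

/-- `j`-th component of `(∇ − 2iπθ)conj(ψ)`. -/
noncomputable def gm {N : ℕ} (θ : Fin N → ℝ) (ψ : (Fin N → ℝ) → ℂ) (j : Fin N)
    (y : Fin N → ℝ) : ℂ :=
  conj (pd ψ j y) - 2 * (π : ℂ) * Complex.I * (θ j : ℂ) * conj (ψ y)

/-- The shifted Bloch cell operator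
`𝔸χ = −div(A(∇χ + 2iπθχ)) − 2iπθ·(A(∇χ + 2iπθχ)) + (c − λ)χ`. -/
noncomputable def blochOp {N : ℕ} (A : (Fin N → ℝ) → Fin N → Fin N → ℝ)
    (c : (Fin N → ℝ) → ℝ) (lam : ℝ) (θ : Fin N → ℝ)
    (χ : (Fin N → ℝ) → ℂ) (y : Fin N → ℝ) : ℂ :=
  - (∑ k : Fin N, fderiv ℝ
      (fun y' => ∑ l : Fin N, (A y' k l : ℂ) * gp θ χ l y') y (Pi.single k 1))
  - (∑ k : Fin N, 2 * (π : ℂ) * Complex.I * (θ k : ℂ)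
      * (∑ l : Fin N, (A y k l : ℂ) * gp θ χ l y))
  + ((c y : ℂ) - (lam : ℂ)) * χ y

/-- The right hand side `2iπ eₘ·(A(∇+2iπθ)χ) + div(2iπ A eₘ χ) + 2iπθ·(2iπ A eₘ χ)`
of the `θ`-differentiated cell equation. -/
noncomputable def dcellθ {N : ℕ} (A : (Fin N → ℝ) → Fin N → Fin N → ℝ)
    (θ : Fin N → ℝ) (χ : (Fin N → ℝ) → ℂ) (m : Fin N) (y : Fin N → ℝ) : ℂ :=
  2 * (π : ℂ) * Complex.I * (∑ l : Fin N, (A y m l : ℂ) * gp θ χ l y)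
  + (∑ k : Fin N, fderiv ℝ
      (fun y' => 2 * (π : ℂ) * Complex.I * (A y' k m : ℂ) * χ y') y (Pi.single k 1))
  + (∑ k : Fin N, 2 * (π : ℂ) * Complex.I * (θ k : ℂ)
      * (2 * (π : ℂ) * Complex.I * (A y k m : ℂ) * χ y))

/-- The right hand side `div(A₁(∇+2iπθ)χ) + 2iπθ·(A₁(∇+2iπθ)χ) − c₁χ`
of the `x`-differentiated cell equation. -/
noncomputable def dcellx {N : ℕ} (A₁ : (Fin N → ℝ) → Fin N → Fin N → ℝ)
    (c₁ : (Fin N → ℝ) → ℝ) (θ : Fin N → ℝ) (χ : (Fin N → ℝ) → ℂ) (y : Fin N → ℝ) : ℂ :=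
  (∑ k : Fin N, fderiv ℝ
      (fun y' => ∑ l : Fin N, (A₁ y' k l : ℂ) * gp θ χ l y') y (Pi.single k 1))
  + (∑ k : Fin N, 2 * (π : ℂ) * Complex.I * (θ k : ℂ)
      * (∑ l : Fin N, (A₁ y k l : ℂ) * gp θ χ l y))
  - (c₁ y : ℂ) * χ y

/-- The unit cell `[0,1]^N`. -/
def unitCell (N : ℕ) : Set (Fin N → ℝ) := Set.univ.pi fun _ => Set.Icc (0 : ℝ) 1

lemma unitCell_eq (N : ℕ) : unitCell N = Set.Icc (0 : Fin N → ℝ) 1 := by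
  unfold unitCell
  exact Set.pi_univ_Icc 0 1

lemma cint {N : ℕ} {f : (Fin N → ℝ) → ℂ} (hf : Continuous f) :
    Integrable f (volume.restrict (unitCell N)) := by
  rw [unitCell_eq]
  exact hf.continuousOn.integrableOn_compact isCompact_Icc

lemma ofReal_smooth {N : ℕ} {f : (Fin N → ℝ) → ℝ} (hf : ContDiff ℝ (⊤ : ℕ∞) f) :
    ContDiff ℝ (⊤ : ℕ∞) (fun y => (f y : ℂ)) :=
  Complex.ofRealCLM.contDiff.comp hf

lemma conj_smooth {N : ℕ} {f : (Fin N → ℝ) → ℂ} (hf : ContDiff ℝ (⊤ : ℕ∞) f) :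
    ContDiff ℝ (⊤ : ℕ∞) (fun y => conj (f y)) :=
  (Complex.conjCLE : ℂ →L[ℝ] ℂ).contDiff.comp hf

lemma pd_smooth {N : ℕ} {f : (Fin N → ℝ) → ℂ} (hf : ContDiff ℝ (⊤ : ℕ∞) f) (k : Fin N) :
    ContDiff ℝ (⊤ : ℕ∞) (fun y => pd f k y) := by
  unfold pd
  exact (hf.fderiv_right (m := ((⊤ : ℕ∞) : WithTop ℕ∞)) (by simp)).clm_apply contDiff_const

lemma pd_per {N : ℕ} {f : (Fin N → ℝ) → ℂ} (hf : ZNPeriodic f) (k : Fin N) :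
    ZNPeriodic (fun y => pd f k y) := by
  intro q y
  have h1 : (fun x => f (x + fun i => (q i : ℝ))) = f := by
    funext x; exact hf q x
  have h2 := fderiv_comp_add_right (𝕜 := ℝ) (f := f) (x := y) (fun i => (q i : ℝ))
  rw [h1] at h2
  simp only [pd]
  rw [h2]
  rfl

lemma gp_smooth {N : ℕ} (θ : Fin N → ℝ) {f : (Fin N → ℝ) → ℂ} (hf : ContDiff ℝ (⊤ : ℕ∞) f)
    (k : Fin N) : ContDiff ℝ (⊤ : ℕ∞) (fun y => gp θ f k y) := by
  unfold gp
  exact (pd_smooth hf k).add (contDiff_const.mul hf)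

lemma gp_per {N : ℕ} (θ : Fin N → ℝ) {f : (Fin N → ℝ) → ℂ} (hf : ZNPeriodic f)
    (k : Fin N) : ZNPeriodic (fun y => gp θ f k y) := by
  intro q y
  have h1 := pd_per hf k q y
  have h2 := hf q y
  simp only [gp] at *
  rw [h1, h2]

lemma gm_eq {N : ℕ} (θ : Fin N → ℝ) (f : (Fin N → ℝ) → ℂ) (k : Fin N) (y : Fin N → ℝ) :
    gm θ f k y = conj (gp θ f k y) := by
  have h2 : conj (2 : ℂ) = 2 := Complex.conj_ofNat 2
  simp [gm, gp, Complex.conj_ofReal, h2]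
  ring

lemma gm_smooth {N : ℕ} (θ : Fin N → ℝ) {f : (Fin N → ℝ) → ℂ} (hf : ContDiff ℝ (⊤ : ℕ∞) f)
    (k : Fin N) : ContDiff ℝ (⊤ : ℕ∞) (fun y => gm θ f k y) := by
  simp only [gm_eq]
  exact conj_smooth (gp_smooth θ hf k)

/-- The divergence of a periodic smooth field has zero integral. -/
lemma div_zero_int {N : ℕ} (G : Fin N → (Fin N → ℝ) → ℂ)
    (hG : ∀ k, ContDiff ℝ (⊤ : ℕ∞) (G k)) (hper : ∀ k, ZNPeriodic (G k)) :
    ∫ y in unitCell N, ∑ k, pd (G k) k y = 0 := by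
  cases N with
  | zero => simp
  | succ n =>
    have hc : Continuous (fun y => ∑ k, pd (G k) k y) :=
      continuous_finsetSum _ fun k _ => (pd_smooth (hG k) k).continuous
    have hi := cint hc
    rw [unitCell_eq] at hi ⊢
    have := integral_divergence_of_hasFDerivAt_off_countable' (E := ℂ) (0 : Fin (n+1) → ℝ) 1
      (zero_le_one) G (fun k y => fderiv ℝ (G k) y) ∅ Set.countable_empty
      (fun i => (hG i).continuous.continuousOn)
      (fun x _ i => ((hG i).differentiable (by simp) x).hasFDerivAt) hi
    refine Eq.trans this ?_
    refine Finset.sum_eq_zero fun i _ => ?_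
    rw [sub_eq_zero]
    congr 1
    funext x
    have := hper i (Pi.single i 1) (i.insertNth 0 x)
    refine Eq.trans ?_ this
    congr 1
    funext j
    refine Fin.succAboveCases i ?_ (fun j => ?_) j
    · simp
    · simp

/-- Integration by parts. -/
lemma ibp {N : ℕ} (θ : Fin N → ℝ) (F : Fin N → (Fin N → ℝ) → ℂ) (ψ : (Fin N → ℝ) → ℂ)
    (hF : ∀ k, ContDiff ℝ (⊤ : ℕ∞) (F k)) (hper : ∀ k, ZNPeriodic (F k))
    (hψ : ContDiff ℝ (⊤ : ℕ∞) ψ) (hψp : ZNPeriodic ψ) :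
    ∫ y in unitCell N, ((∑ k, fderiv ℝ (F k) y (Pi.single k 1))
        + ∑ k, 2 * (π : ℂ) * Complex.I * (θ k : ℂ) * F k y) * conj (ψ y)
      = - ∫ y in unitCell N, ∑ k, F k y * gm θ ψ k y := by
  have h0 := div_zero_int (fun k y => F k y * conj (ψ y))
    (fun k => (hF k).mul (conj_smooth hψ))
    (fun k q y => by
      have h1 := hper k q y
      have h2 := hψp q y
      simp only [h1, h2])
  have hpt : ∀ y, ((∑ k, fderiv ℝ (F k) y (Pi.single k 1))
        + ∑ k, 2 * (π : ℂ) * Complex.I * (θ k : ℂ) * F k y) * conj (ψ y)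
      = (∑ k, pd (fun y => F k y * conj (ψ y)) k y) - ∑ k, F k y * gm θ ψ k y := by
    intro y
    rw [← Finset.sum_add_distrib, ← Finset.sum_sub_distrib, Finset.sum_mul]
    refine Finset.sum_congr rfl fun k _ => ?_
    have hd1 := ((hF k).differentiable (by simp) y).hasFDerivAt
    have hd2 := (hψ.differentiable (by simp) y).hasFDerivAt
    have hd3 : HasFDerivAt (fun y => conj (ψ y)) _ y :=
      (Complex.conjCLE : ℂ →L[ℝ] ℂ).hasFDerivAt.comp y hd2
    have hd4 := hd1.mul hd3
    have h5 : pd (fun y => F k y * conj (ψ y)) k y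
        = F k y * conj (pd ψ k y) + conj (ψ y) * pd (F k) k y := by
      unfold pd
      erw [hd4.fderiv]
      simp
    rw [h5]
    simp only [gm, pd]
    ring
  simp only [hpt]
  rw [integral_sub, h0, zero_sub]
  · exact cint (continuous_finsetSum _ fun k _ =>
      (pd_smooth ((hF k).mul (conj_smooth hψ)) k).continuous)
  · exact cint (continuous_finsetSum _ fun k _ =>
      (hF k).continuous.mul (gm_smooth θ hψ k).continuous)

section fluxes
variable {N : ℕ} (θ : Fin N → ℝ) (A : (Fin N → ℝ) → Fin N → Fin N → ℝ)
  (hA_reg : ∀ k l, ContDiff ℝ (⊤ : ℕ∞) (fun y => A y k l))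
  (hA_per : ∀ k l, ZNPeriodic (fun y => A y k l))

lemma flux_smooth (hA_reg : ∀ k l, ContDiff ℝ (⊤ : ℕ∞) (fun y => A y k l))
    {u : (Fin N → ℝ) → ℂ} (hu : ContDiff ℝ (⊤ : ℕ∞) u) (k : Fin N) :
    ContDiff ℝ (⊤ : ℕ∞) (fun y => ∑ l : Fin N, (A y k l : ℂ) * gp θ u l y) :=
  ContDiff.sum fun l _ => (ofReal_smooth (hA_reg k l)).mul (gp_smooth θ hu l)

lemma flux_per (hA_per : ∀ k l, ZNPeriodic (fun y => A y k l))
    {u : (Fin N → ℝ) → ℂ} (hu : ZNPeriodic u) (k : Fin N) :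
    ZNPeriodic (fun y => ∑ l : Fin N, (A y k l : ℂ) * gp θ u l y) := by
  intro q y
  refine Finset.sum_congr rfl fun l _ => ?_
  have h1 := hA_per k l q y
  have h2 := gp_per θ hu l q y
  simp only at h1 h2
  rw [h1, h2]

/-- Weak form of `dcellx`. -/
lemma dcellx_int (hA_reg : ∀ k l, ContDiff ℝ (⊤ : ℕ∞) (fun y => A y k l))
    (hA_per : ∀ k l, ZNPeriodic (fun y => A y k l))
    (c : (Fin N → ℝ) → ℝ) (hc : ContDiff ℝ (⊤ : ℕ∞) c)
    {u v : (Fin N → ℝ) → ℂ} (hu : ContDiff ℝ (⊤ : ℕ∞) u) (hup : ZNPeriodic u)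
    (hv : ContDiff ℝ (⊤ : ℕ∞) v) (hvp : ZNPeriodic v) :
    Integrable (fun y => dcellx A c θ u y * conj (v y)) (volume.restrict (unitCell N)) ∧
    ∫ y in unitCell N, dcellx A c θ u y * conj (v y)
      = - ∫ y in unitCell N, ((∑ j, (∑ m, (A y j m : ℂ) * gp θ u m y) * gm θ v j y)
            + (c y : ℂ) * u y * conj (v y)) := by
  have hfs := flux_smooth θ A hA_reg hu
  have h := ibp θ (fun k y => ∑ l : Fin N, (A y k l : ℂ) * gp θ u l y) v
    hfs (flux_per θ A hA_per hup) hv hvp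
  have hcc : Continuous (fun y => (c y : ℂ) * u y * conj (v y)) :=
    ((ofReal_smooth hc).continuous.mul hu.continuous).mul (conj_smooth hv).continuous
  have hd : Continuous (fun y => ((∑ k : Fin N, fderiv ℝ
      (fun y' => ∑ l : Fin N, (A y' k l : ℂ) * gp θ u l y') y (Pi.single k 1))
      + (∑ k : Fin N, 2 * (π : ℂ) * Complex.I * (θ k : ℂ)
      * (∑ l : Fin N, (A y k l : ℂ) * gp θ u l y))) * conj (v y)) :=
    ((continuous_finsetSum _ fun k _ => (pd_smooth (hfs k) k).continuous).add
      (continuous_finsetSum _ fun k _ => continuous_const.mul (hfs k).continuous)).mul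
      (conj_smooth hv).continuous
  simp only [dcellx, sub_mul _ ((c _ : ℂ) * u _)]
  refine ⟨(cint hd).sub (cint hcc), ?_⟩
  rw [integral_sub (cint hd) (cint hcc), h, integral_add, neg_add, sub_eq_add_neg]
  · exact cint (continuous_finsetSum _ fun k _ =>
      (hfs k).continuous.mul (gm_smooth θ hv k).continuous)
  · exact cint hcc

/-- Weak form of `dcellθ`. -/
lemma dcellθ_int (hA_reg : ∀ k l, ContDiff ℝ (⊤ : ℕ∞) (fun y => A y k l))
    (hA_per : ∀ k l, ZNPeriodic (fun y => A y k l))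
    (hA_symm : ∀ y k l, A y k l = A y l k) (k : Fin N)
    {u v : (Fin N → ℝ) → ℂ} (hu : ContDiff ℝ (⊤ : ℕ∞) u) (hup : ZNPeriodic u)
    (hv : ContDiff ℝ (⊤ : ℕ∞) v) (hvp : ZNPeriodic v) :
    Integrable (fun y => dcellθ A θ u k y * conj (v y)) (volume.restrict (unitCell N)) ∧
    ∫ y in unitCell N, dcellθ A θ u k y * conj (v y)
      = 2 * (π : ℂ) * Complex.I *
        ((∫ y in unitCell N, ∑ j, (A y j k : ℂ) * gp θ u j y * conj (v y))
        - ∫ y in unitCell N, ∑ j, (A y j k : ℂ) * u y * gm θ v j y) := by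
  have hfs : ∀ j, ContDiff ℝ (⊤ : ℕ∞)
      (fun y => 2 * (π : ℂ) * Complex.I * (A y j k : ℂ) * u y) := fun j =>
    (contDiff_const.mul (ofReal_smooth (hA_reg j k))).mul hu
  have h := ibp θ (fun j y => 2 * (π : ℂ) * Complex.I * (A y j k : ℂ) * u y) v
    hfs (fun j q y => by
      have h1 := hA_per j k q y
      have h2 := hup q y
      simp only at h1 h2
      simp only [h1, h2]) hv hvp
  have hd : Continuous (fun y => ((∑ j : Fin N, fderiv ℝ
      (fun y' => 2 * (π : ℂ) * Complex.I * (A y' j k : ℂ) * u y') y (Pi.single j 1))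
      + (∑ j : Fin N, 2 * (π : ℂ) * Complex.I * (θ j : ℂ)
      * (2 * (π : ℂ) * Complex.I * (A y j k : ℂ) * u y))) * conj (v y)) :=
    ((continuous_finsetSum _ fun k _ => (pd_smooth (hfs k) k).continuous).add
      (continuous_finsetSum _ fun k _ => continuous_const.mul (hfs k).continuous)).mul
      (conj_smooth hv).continuous
  have he : Continuous (fun y => ∑ j, (A y j k : ℂ) * gp θ u j y * conj (v y)) :=
    continuous_finsetSum _ fun j _ => ((ofReal_smooth (hA_reg j k)).continuous.mul
      (gp_smooth θ hu j).continuous).mul (conj_smooth hv).continuous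
  have hpt : ∀ y, dcellθ A θ u k y * conj (v y) =
      2 * (π : ℂ) * Complex.I * (∑ j, (A y j k : ℂ) * gp θ u j y * conj (v y))
      + ((∑ j : Fin N, fderiv ℝ
      (fun y' => 2 * (π : ℂ) * Complex.I * (A y' j k : ℂ) * u y') y (Pi.single j 1))
      + (∑ j : Fin N, 2 * (π : ℂ) * Complex.I * (θ j : ℂ)
      * (2 * (π : ℂ) * Complex.I * (A y j k : ℂ) * u y))) * conj (v y) := by
    intro y
    simp only [dcellθ, hA_symm y k]
    rw [← Finset.sum_mul]
    ring
  simp only [hpt]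
  have he' := (cint he).const_mul (2 * (π : ℂ) * Complex.I)
  refine ⟨he'.add (cint hd), ?_⟩
  rw [integral_add he' (cint hd), h, integral_const_mul, mul_sub, sub_eq_add_neg]
  congr 2
  rw [← integral_const_mul]
  congr 1
  funext y
  rw [Finset.mul_sum]
  refine Finset.sum_congr rfl fun j _ => ?_
  ring

lemma blochOp_eq (c : (Fin N → ℝ) → ℝ) (lam : ℝ) (u : (Fin N → ℝ) → ℂ) (y : Fin N → ℝ) :
    blochOp A c lam θ u y = - dcellx A (fun y => c y - lam) θ u y := by
  simp only [blochOp, dcellx]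
  push_cast
  ring

/-- Self-adjointness of `dcellx`. -/
lemma dcellx_symm (hA_reg : ∀ k l, ContDiff ℝ (⊤ : ℕ∞) (fun y => A y k l))
    (hA_per : ∀ k l, ZNPeriodic (fun y => A y k l))
    (hA_symm : ∀ y k l, A y k l = A y l k)
    (c : (Fin N → ℝ) → ℝ) (hc : ContDiff ℝ (⊤ : ℕ∞) c)
    {u v : (Fin N → ℝ) → ℂ} (hu : ContDiff ℝ (⊤ : ℕ∞) u) (hup : ZNPeriodic u)
    (hv : ContDiff ℝ (⊤ : ℕ∞) v) (hvp : ZNPeriodic v) :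
    ∫ y in unitCell N, dcellx A c θ u y * conj (v y)
      = conj (∫ y in unitCell N, dcellx A c θ v y * conj (u y)) := by
  rw [(dcellx_int θ A hA_reg hA_per c hc hu hup hv hvp).2,
    (dcellx_int θ A hA_reg hA_per c hc hv hvp hu hup).2, map_neg, ← integral_conj]
  congr 2
  funext y
  simp only [map_add, map_sum, map_mul, gm_eq, Complex.conj_conj, Complex.conj_ofReal,
    Finset.sum_mul]
  rw [Finset.sum_comm]
  congr 1
  · refine Finset.sum_congr rfl fun i _ => Finset.sum_congr rfl fun j _ => ?_
    rw [hA_symm y j i]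
    ring
  · ring

end fluxes

theorem mixed_hessian_identity
    (N : ℕ) (hN : 1 ≤ N) (θ : Fin N → ℝ)
    (A : (Fin N → ℝ) → Fin N → Fin N → ℝ)
    (hA_reg : ∀ k l, ContDiff ℝ (⊤ : ℕ∞) (fun y => A y k l))
    (hA_per : ∀ k l, ZNPeriodic (fun y => A y k l))
    (hA_symm : ∀ y k l, A y k l = A y l k)
    (c : (Fin N → ℝ) → ℝ) (hc_reg : ContDiff ℝ (⊤ : ℕ∞) c) (hc_per : ZNPeriodic c)
    (lam : ℝ)
    (ψ : (Fin N → ℝ) → ℂ)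
    (hψ_reg : ContDiff ℝ (⊤ : ℕ∞) ψ) (hψ_per : ZNPeriodic ψ)
    (hψ_norm : ∫ y in unitCell N, ‖ψ y‖ ^ 2 = 1)
    (hψ_eq : ∀ y, blochOp A c lam θ ψ y = 0)
    (h k : Fin N)
    (A₁ : (Fin N → ℝ) → Fin N → Fin N → ℝ)
    (hA₁_reg : ∀ j m, ContDiff ℝ (⊤ : ℕ∞) (fun y => A₁ y j m))
    (hA₁_per : ∀ j m, ZNPeriodic (fun y => A₁ y j m))
    (hA₁_symm : ∀ y j m, A₁ y j m = A₁ y m j)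
    (c₁ : (Fin N → ℝ) → ℝ) (hc₁_reg : ContDiff ℝ (⊤ : ℕ∞) c₁) (hc₁_per : ZNPeriodic c₁)
    (φk χh : (Fin N → ℝ) → ℂ)
    (hφk_reg : ContDiff ℝ (⊤ : ℕ∞) φk) (hφk_per : ZNPeriodic φk)
    (hχh_reg : ContDiff ℝ (⊤ : ℕ∞) χh) (hχh_per : ZNPeriodic χh)
    (hφk_eq : ∀ y, blochOp A c lam θ φk y = dcellθ A θ ψ k y)
    (hχh_eq : ∀ y, blochOp A c lam θ χh y = dcellx A₁ c₁ θ ψ y)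
    (ξ : (Fin N → ℝ) → ℂ) (Λ : ℂ)
    (hξ_reg : ContDiff ℝ (⊤ : ℕ∞) ξ) (hξ_per : ZNPeriodic ξ)
    (hξ_eq : ∀ y, blochOp A c lam θ ξ y =
      dcellx A₁ c₁ θ φk y + dcellθ A θ χh k y + dcellθ A₁ θ ψ k y + Λ * ψ y) :
    (∫ y in unitCell N,
        (1 / (2 * (π : ℂ) * Complex.I))
          * ((∑ j : Fin N, (∑ m : Fin N, (A₁ y j m : ℂ) * gp θ φk m y) * gm θ ψ j y)
            + (c₁ y : ℂ) * φk y * conj (ψ y)))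
    + (∫ y in unitCell N,
        ((∑ j : Fin N, (A₁ y j k : ℂ) * ψ y * gm θ ψ j y)
          + (∑ j : Fin N, (A y j k : ℂ) * χh y * gm θ ψ j y)))
    - (∫ y in unitCell N,
        ((∑ j : Fin N, (A₁ y j k : ℂ) * gp θ ψ j y * conj (ψ y))
          + (∑ j : Fin N, (A y j k : ℂ) * gp θ χh j y * conj (ψ y))))
    - (1 / (2 * (π : ℂ) * Complex.I)) * Λ = 0 := by
  have hx := dcellx_int θ A₁ hA₁_reg hA₁_per c₁ hc₁_reg hφk_reg hφk_per hψ_reg hψ_per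
  have ht1 := dcellθ_int θ A hA_reg hA_per hA_symm k hχh_reg hχh_per hψ_reg hψ_per
  have ht2 := dcellθ_int θ A₁ hA₁_reg hA₁_per hA₁_symm k hψ_reg hψ_per hψ_reg hψ_per
  have hcl : ContDiff ℝ (⊤ : ℕ∞) (fun y => c y - lam) := hc_reg.sub contDiff_const
  -- the left-hand side is orthogonal to `ψ`
  have hL : ∫ y in unitCell N, blochOp A c lam θ ξ y * conj (ψ y) = 0 := by
    simp only [blochOp_eq, neg_mul] at hψ_eq ⊢
    rw [integral_neg, dcellx_symm θ A hA_reg hA_per hA_symm _ hcl hξ_reg hξ_per hψ_reg hψ_per]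
    simp only [neg_eq_zero] at hψ_eq
    simp [hψ_eq]
  have hn : ∫ y in unitCell N, ψ y * conj (ψ y) = 1 := by
    have : ∀ y, ψ y * conj (ψ y) = ((‖ψ y‖ ^ 2 : ℝ) : ℂ) := fun y => by
      rw [Complex.mul_conj, Complex.normSq_eq_norm_sq]
    simp only [this]
    rw [integral_complex_ofReal, hψ_norm, Complex.ofReal_one]
  have hni : Integrable (fun y => Λ * (ψ y * conj (ψ y))) (volume.restrict (unitCell N)) :=
    (cint (hψ_reg.continuous.mul (conj_smooth hψ_reg).continuous)).const_mul Λ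
  simp only [hξ_eq, add_mul, mul_assoc Λ] at hL
  have hi1 : Integrable (fun y => dcellx A₁ c₁ θ φk y * conj (ψ y)
      + dcellθ A θ χh k y * conj (ψ y)) (volume.restrict (unitCell N)) := hx.1.add ht1.1
  have hi2 : Integrable (fun y => dcellx A₁ c₁ θ φk y * conj (ψ y)
      + dcellθ A θ χh k y * conj (ψ y) + dcellθ A₁ θ ψ k y * conj (ψ y))
      (volume.restrict (unitCell N)) := hi1.add ht2.1
  rw [integral_add hi2 hni, integral_add hi1 ht2.1,
    integral_add hx.1 ht1.1, integral_const_mul, hn, hx.2, ht1.2, ht2.2] at hL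
  have hc1 : ∀ (B : (Fin N → ℝ) → Fin N → Fin N → ℝ)
      (_ : ∀ k l, ContDiff ℝ (⊤ : ℕ∞) (fun y => B y k l)) (u : (Fin N → ℝ) → ℂ)
      (_ : ContDiff ℝ (⊤ : ℕ∞) u), Integrable (fun y => ∑ j, (B y j k : ℂ) * u y * gm θ ψ j y)
        (volume.restrict (unitCell N)) := fun B hB u hu =>
    cint (continuous_finsetSum _ fun j _ => ((ofReal_smooth (hB j k)).continuous.mul
      hu.continuous).mul (gm_smooth θ hψ_reg j).continuous)
  have hc2 : ∀ (B : (Fin N → ℝ) → Fin N → Fin N → ℝ)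
      (_ : ∀ k l, ContDiff ℝ (⊤ : ℕ∞) (fun y => B y k l)) (u : (Fin N → ℝ) → ℂ)
      (_ : ContDiff ℝ (⊤ : ℕ∞) u),
      Integrable (fun y => ∑ j, (B y j k : ℂ) * gp θ u j y * conj (ψ y))
        (volume.restrict (unitCell N)) := fun B hB u hu =>
    cint (continuous_finsetSum _ fun j _ => ((ofReal_smooth (hB j k)).continuous.mul
      (gp_smooth θ hu j).continuous).mul (conj_smooth hψ_reg).continuous)
  rw [integral_const_mul, integral_add (hc1 A₁ hA₁_reg ψ hψ_reg) (hc1 A hA_reg χh hχh_reg),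
    integral_add (hc2 A₁ hA₁_reg ψ hψ_reg) (hc2 A hA_reg χh hχh_reg)]
  have hpi : 2 * (π : ℂ) * Complex.I ≠ 0 := Complex.two_pi_I_ne_zero
  generalize 2 * (π : ℂ) * Complex.I = s at hL hpi ⊢
  field_simp
  linear_combination -hL
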